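/- arXiv:0908.3529 — 2 statements merged into one kernel-verified Lean document; each statement's English description precedes it below -/
import Mathlib

section
/- Under conditions (C.1), (C.2), (C.4), (C.5), for every t the conditional expectation of the next cost satisfies, almost surely: E[C(w_{t+1}) | ℱ_t] ≤ C(w_t)·(1 + a_t² B K M²) + A K M² a_t² − m a_t ‖∇C(w_t)‖². -/
open MeasureTheory Filter
open scoped Topology RealInnerProductSpace

/-- Descent lemma: the quadratic upper bound for a function with bounded Hessian. -/
theorem le_add_inner_gradient_add_of_norm_fderiv_gradient_le
    {E : Type*} [NormedAddCommGroup E] [InnerProductSpace ℝ E] [CompleteSpace E]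
    {f : E → ℝ} {K : ℝ} (hf : Differentiable ℝ f) (hf' : Differentiable ℝ (gradient f))
    (hK : ∀ v, ‖fderiv ℝ (gradient f) v‖ ≤ 2 * K) (x d : E) :
    f (x + d) ≤ f x + ⟪gradient f x, d⟫ + K * ‖d‖ ^ 2 := by
  have hderiv : ∀ s : ℝ, HasDerivAt
      (fun s : ℝ => f (x + s • d) - s * ⟪gradient f x, d⟫ - K * ‖d‖ ^ 2 * s ^ 2)
      (⟪gradient f (x + s • d), d⟫ - ⟪gradient f x, d⟫ - K * ‖d‖ ^ 2 * (2 * s)) s := by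
    intro s
    have hline : HasDerivAt (fun s : ℝ => x + s • d) d s := by
      simpa using ((hasDerivAt_id s).smul_const d).const_add x
    have hcomp : HasDerivAt (fun s : ℝ => f (x + s • d)) ⟪gradient f (x + s • d), d⟫ s := by
      rw [inner_gradient_left]
      exact (hf (x + s • d)).hasFDerivAt.comp_hasDerivAt s hline
    have hlin := (hasDerivAt_id s).mul_const ⟪gradient f x, d⟫
    have hquad := (hasDerivAt_pow 2 s).const_mul (K * ‖d‖ ^ 2)
    exact ((hcomp.sub hlin).sub hquad).congr_deriv (by simp)
  have hanti : AntitoneOn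
      (fun s : ℝ => f (x + s • d) - s * ⟪gradient f x, d⟫ - K * ‖d‖ ^ 2 * s ^ 2)
      (Set.Icc 0 1) := by
    refine antitoneOn_of_deriv_nonpos (convex_Icc 0 1)
      (fun s _ => (hderiv s).continuousAt.continuousWithinAt)
      (fun s _ => (hderiv s).differentiableAt.differentiableWithinAt) fun s hs => ?_
    rw [interior_Icc] at hs
    rw [(hderiv s).deriv, ← inner_sub_left]
    have hlip : ‖gradient f (x + s • d) - gradient f x‖ ≤ 2 * K * (s * ‖d‖) := by
      have := convex_univ.norm_image_sub_le_of_norm_fderiv_le (fun v _ => hf' v)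
        (fun v _ => hK v) (Set.mem_univ x) (Set.mem_univ (x + s • d))
      rwa [add_sub_cancel_left, norm_smul, Real.norm_of_nonneg hs.1.le] at this
    have := real_inner_le_norm (gradient f (x + s • d) - gradient f x) d
    have := mul_le_mul_of_nonneg_right hlip (norm_nonneg d)
    linarith
  have := hanti (Set.left_mem_Icc.2 zero_le_one) (Set.right_mem_Icc.2 zero_le_one) zero_le_one
  simp only [one_smul, zero_smul, add_zero] at this
  linarith

/-- A symmetric nonnegative operator whose quadratic form is at most `M` has norm at most `M`. -/
theorem ContinuousLinearMap.opNorm_le_of_inner_self_le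
    {E : Type*} [NormedAddCommGroup E] [InnerProductSpace ℝ E]
    {T : E →L[ℝ] E} {M : ℝ} (hT : ∀ u v, ⟪T u, v⟫ = ⟪u, T v⟫) (hM : 0 ≤ M)
    (hpos : ∀ v, 0 ≤ ⟪v, T v⟫) (hle : ∀ v, ⟪v, T v⟫ ≤ M * ‖v‖ ^ 2) : ‖T‖ ≤ M := by
  rw [T.norm_eq_iSup_rayleighQuotient hT]
  refine ciSup_le fun x => ?_
  rw [rayleighQuotient, abs_div, abs_sq]
  refine div_le_of_le_mul₀ (sq_nonneg _) hM ?_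
  have hx : T.reApplyInnerSelf x = ⟪x, T x⟫ := hT x x
  rw [hx, abs_of_nonneg (hpos x)]
  exact hle x

/-- The inner product of two square-integrable functions is integrable. -/
theorem MeasureTheory.MemLp.integrable_real_inner
    {Ω E : Type*} {m0 : MeasurableSpace Ω} {μ : Measure Ω}
    [NormedAddCommGroup E] [InnerProductSpace ℝ E] {f g : Ω → E}
    (hf : MemLp f 2 μ) (hg : MemLp g 2 μ) : Integrable (fun ω => ⟪f ω, g ω⟫) μ :=
  (hf.norm.integrable_mul hg.norm).mono (hf.1.inner hg.1) <| ae_of_all _ fun ω => by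
    simpa using abs_real_inner_le_norm (f ω) (g ω)

/-- **Key one-step conditional expectation bound** (inequality (13) of the
paper). Under (C.1), (C.2), (C.4), (C.5), for every `t`, almost surely
`E[C (w (t+1)) | ℱ t] ≤ C (w t) (1 + a t ² B K M²) + A K M² a t ² - m a t ‖∇C (w t)‖²`. -/
theorem one_step_conditional_bound
    {n : ℕ} {Ω : Type*} {m0 : MeasurableSpace Ω}
    {μ : Measure Ω} [IsProbabilityMeasure μ] (ℱ : Filtration ℕ m0)
    (C : EuclideanSpace ℝ (Fin n) → ℝ)
    (hC : ContDiff ℝ 2 C)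
    (w Y : ℕ → Ω → EuclideanSpace ℝ (Fin n))
    (B : ℕ → Ω → (EuclideanSpace ℝ (Fin n) →L[ℝ] EuclideanSpace ℝ (Fin n)))
    (a : ℕ → ℝ) (ha : ∀ t, 0 < a t)
    (hw_meas : ∀ t, StronglyMeasurable[ℱ t] (w t))
    (hB_meas : ∀ t, StronglyMeasurable[ℱ t] (B t))
    (hY_meas : ∀ t, StronglyMeasurable[ℱ (t + 1)] (Y t))
    (hY_int : ∀ t, Integrable (Y t) μ)
    (hCw_int : ∀ t, Integrable (fun ω => C (w t ω)) μ)
    (hupdate : ∀ t ω, w (t + 1) ω = w t ω - a t • (B t ω) (Y t ω))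
    -- (C.1)
    (hC1 : ∀ t, μ[Y t | ℱ t] =ᵐ[μ] fun ω => gradient C (w t ω))
    -- (C.2)
    (K : ℝ) (hC2 : ∀ v, ‖fderiv ℝ (gradient C) v‖ ≤ 2 * K)
    -- (C.4)
    (A Bc : ℝ) (hA : 0 ≤ A) (hBc : 0 ≤ Bc)
    (hYsq_int : ∀ t, Integrable (fun ω => ‖Y t ω‖ ^ 2) μ)
    (hC4 : ∀ t, ∀ᵐ ω ∂μ,
      (μ[fun ω' => ‖Y t ω'‖ ^ 2 | ℱ t]) ω ≤ A + Bc * C (w t ω))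
    -- (C.5)
    (m M : ℝ) (hm : 0 < m) (hmM : m < M)
    (hC5 : ∀ t, ∀ᵐ ω ∂μ,
      (∀ u v, ⟪(B t ω) u, v⟫ = ⟪u, (B t ω) v⟫) ∧
        ∀ v, m * ‖v‖ ^ 2 ≤ ⟪v, (B t ω) v⟫ ∧ ⟪v, (B t ω) v⟫ ≤ M * ‖v‖ ^ 2) :
    ∀ t, ∀ᵐ ω ∂μ,
      (μ[fun ω' => C (w (t + 1) ω') | ℱ t]) ω ≤
        C (w t ω) * (1 + (a t) ^ 2 * Bc * K * M ^ 2) + A * K * M ^ 2 * (a t) ^ 2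
          - m * a t * ‖gradient C (w t ω)‖ ^ 2 := by
  intro t
  have hM : 0 ≤ M := (hm.trans hmM).le
  have hK : 0 ≤ K := by
    have := (norm_nonneg _).trans (hC2 0)
    linarith
  have hgrad : ContDiff ℝ 1 (gradient C) :=
    (InnerProductSpace.toDual ℝ _).symm.contDiff.comp (hC.fderiv_right (by norm_num))
  have hBnorm : ∀ᵐ ω ∂μ, ‖B t ω‖ ≤ M := by
    filter_upwards [hC5 t] with ω hω
    exact ContinuousLinearMap.opNorm_le_of_inner_self_le hω.1 hM
      (fun v => (by positivity : (0 : ℝ) ≤ m * ‖v‖ ^ 2).trans (hω.2 v).1) fun v => (hω.2 v).2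
  have hY2 : MemLp (Y t) 2 μ :=
    (memLp_two_iff_integrable_sq_norm (hY_int t).1).2 (hYsq_int t)
  have hgrad_meas : StronglyMeasurable[ℱ t] fun ω => gradient C (w t ω) :=
    hgrad.continuous.comp_stronglyMeasurable (hw_meas t)
  have hdir_meas : StronglyMeasurable[ℱ t] fun ω => B t ω (gradient C (w t ω)) :=
    (show Continuous fun p : (EuclideanSpace ℝ (Fin n) →L[ℝ] EuclideanSpace ℝ (Fin n)) ×
      EuclideanSpace ℝ (Fin n) => p.1 p.2 by fun_prop).comp_stronglyMeasurable
      ((hB_meas t).prodMk hgrad_meas)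
  have hgrad2 : MemLp (fun ω => gradient C (w t ω)) 2 μ :=
    (memLp_congr_ae (hC1 t)).1 (hY2.condExp one_le_two)
  have hdir2 : MemLp (fun ω => B t ω (gradient C (w t ω))) 2 μ := by
    refine hgrad2.of_le_mul (c := M) (hdir_meas.mono (ℱ.le t)).aestronglyMeasurable ?_
    filter_upwards [hBnorm] with ω hω
    exact (B t ω).le_of_opNorm_le hω _
  have hinner_int := hdir2.integrable_real_inner hY2
  have hinner : μ[fun ω => ⟪B t ω (gradient C (w t ω)), Y t ω⟫ | ℱ t] =ᵐ[μ]
      fun ω => ⟪B t ω (gradient C (w t ω)), (μ[Y t | ℱ t]) ω⟫ :=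
    condExp_bilin_of_stronglyMeasurable_left (innerSL ℝ) hdir_meas hinner_int (hY_int t)
  have hlin_int := hinner_int.const_mul (a t)
  have hquad_int := (hYsq_int t).const_mul (K * M ^ 2 * a t ^ 2)
  have hstep : (fun ω => C (w (t + 1) ω)) ≤ᵐ[μ]
      ((fun ω => C (w t ω)) - fun ω => a t * ⟪B t ω (gradient C (w t ω)), Y t ω⟫) +
        fun ω => K * M ^ 2 * a t ^ 2 * ‖Y t ω‖ ^ 2 := by
    filter_upwards [hC5 t, hBnorm] with ω hsymm hω
    have hdesc := le_add_inner_gradient_add_of_norm_fderiv_gradient_le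
      (hC.differentiable (by norm_num)) (hgrad.differentiable (by norm_num)) hC2
      (w t ω) (-(a t • B t ω (Y t ω)))
    rw [← sub_eq_add_neg, ← hupdate, inner_neg_right, real_inner_smul_right, ← hsymm.1,
      norm_neg, norm_smul, Real.norm_of_nonneg (ha t).le, mul_pow] at hdesc
    have hBY : ‖B t ω (Y t ω)‖ ^ 2 ≤ (M * ‖Y t ω‖) ^ 2 :=
      pow_le_pow_left₀ (norm_nonneg _) ((B t ω).le_of_opNorm_le hω _) 2
    have := mul_le_mul_of_nonneg_left hBY (mul_nonneg hK (sq_nonneg (a t)))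
    simp only [Pi.add_apply, Pi.sub_apply]
    linarith
  have hCw : μ[fun ω => C (w t ω) | ℱ t] = fun ω => C (w t ω) :=
    condExp_of_stronglyMeasurable (ℱ.le t)
      (hC.continuous.comp_stronglyMeasurable (hw_meas t)) (hCw_int t)
  filter_upwards [condExp_mono (m := ℱ t) (hCw_int (t + 1))
      (((hCw_int t).sub hlin_int).add hquad_int) hstep,
    condExp_add ((hCw_int t).sub hlin_int) hquad_int (ℱ t),
    condExp_sub (hCw_int t) hlin_int (ℱ t),
    condExp_smul (a t) (fun ω => ⟪B t ω (gradient C (w t ω)), Y t ω⟫) (ℱ t) (μ := μ),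
    condExp_smul (K * M ^ 2 * a t ^ 2) (fun ω => ‖Y t ω‖ ^ 2) (ℱ t) (μ := μ),
    hinner, hC1 t, hC4 t, hC5 t] with ω hmono hadd hsub hlin hquad hin hgradω hsq hpos
  change (μ[fun ω => a t * ⟪B t ω (gradient C (w t ω)), Y t ω⟫ | ℱ t]) ω = a t * _ at hlin
  change (μ[fun ω => K * M ^ 2 * a t ^ 2 * ‖Y t ω‖ ^ 2 | ℱ t]) ω =
    K * M ^ 2 * a t ^ 2 * _ at hquad
  rw [hin, hgradω, real_inner_comm] at hlin
  rw [hadd, Pi.add_apply, hsub, Pi.sub_apply, hCw, hlin, hquad] at hmono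
  have hlower := mul_le_mul_of_nonneg_left (hpos.2 (gradient C (w t ω))).1 (ha t).le
  have hupper := mul_le_mul_of_nonneg_left hsq
    (by positivity : (0 : ℝ) ≤ K * M ^ 2 * a t ^ 2)
  linarith
end

section
/- Under conditions (C.1)–(C.6) with C non-negative, almost surely: the sequence C(w_t) converges to a (finite) random variable as t → ∞, and Σ_t a_t ‖∇C(w_t)‖² < ∞. -/
open MeasureTheory Filter
open scoped Topology RealInnerProductSpace

/-- **Descent lemma**: a function whose gradient has derivative bounded by `2 * K` lies below
its quadratic upper model. -/
theorem le_add_inner_gradient_add_sq {E : Type*} [NormedAddCommGroup E] [InnerProductSpace ℝ E]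
    [CompleteSpace E] {f : E → ℝ} (hf : Differentiable ℝ f)
    (hf' : Differentiable ℝ (gradient f)) {K : ℝ} (hK : ∀ v, ‖fderiv ℝ (gradient f) v‖ ≤ 2 * K)
    (x d : E) : f (x + d) ≤ f x + ⟪gradient f x, d⟫ + K * ‖d‖ ^ 2 := by
  have hline (s : ℝ) : HasDerivAt (fun s : ℝ => x + s • d) d s := by
    simpa using ((hasDerivAt_id s).smul_const d).const_add x
  have hderiv (s : ℝ) : HasDerivAt
      (fun s : ℝ => f (x + s • d) - s * ⟪gradient f x, d⟫ - K * ‖d‖ ^ 2 * s ^ 2)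
      (⟪gradient f (x + s • d) - gradient f x, d⟫ - 2 * K * s * ‖d‖ ^ 2) s := by
    have h1 := ((hf (x + s • d)).hasFDerivAt.comp_hasDerivAt s (hline s))
    rw [← inner_gradient_left] at h1
    refine ((h1.sub ((hasDerivAt_id s).mul_const ⟪gradient f x, d⟫)).sub
      (((hasDerivAt_id s).pow 2).const_mul (K * ‖d‖ ^ 2))).congr_deriv ?_
    rw [inner_sub_left, id]
    ring
  have hanti := antitoneOn_of_hasDerivWithinAt_nonpos (convex_Icc (0 : ℝ) 1)
    (fun s _ => (hderiv s).continuousAt.continuousWithinAt)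
    (fun s _ => (hderiv s).hasDerivWithinAt) (fun s hs => by
      rw [interior_Icc] at hs
      have hlip := Convex.norm_image_sub_le_of_norm_fderiv_le (𝕜 := ℝ) (fun v _ => hf' v)
        (fun v _ => hK v) convex_univ (Set.mem_univ x) (Set.mem_univ (x + s • d))
      rw [add_sub_cancel_left, norm_smul, Real.norm_of_nonneg hs.1.le] at hlip
      have hcs := real_inner_le_norm (gradient f (x + s • d) - gradient f x) d
      nlinarith [mul_le_mul_of_nonneg_right hlip (norm_nonneg d)])
  have := hanti (Set.left_mem_Icc.2 zero_le_one) (Set.right_mem_Icc.2 zero_le_one) zero_le_one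
  simp only [one_smul, one_mul, one_pow, mul_one, zero_smul, add_zero, zero_mul, sub_zero, ne_eq,
    OfNat.ofNat_ne_zero, not_false_eq_true, zero_pow, mul_zero] at this
  linarith

/-- A symmetric operator whose quadratic form lies between `0` and `M * ‖v‖ ^ 2` has norm at
most `M`. -/
theorem norm_apply_le_of_symmetric_of_inner_le {E : Type*} [NormedAddCommGroup E]
    [InnerProductSpace ℝ E] {T : E →L[ℝ] E} {M : ℝ} (hM : 0 < M)
    (hsymm : ∀ u v, ⟪T u, v⟫ = ⟪u, T v⟫) (hpos : ∀ v, 0 ≤ ⟪v, T v⟫)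
    (hle : ∀ v, ⟪v, T v⟫ ≤ M * ‖v‖ ^ 2) (v : E) : ‖T v‖ ≤ M * ‖v‖ := by
  have h1 := hpos (M • v - T v)
  have h2 := hle v
  have h3 := hle (T v)
  rw [map_sub, map_smul, inner_sub_left, inner_sub_right, inner_sub_right, real_inner_smul_left,
    real_inner_smul_left, real_inner_smul_right, real_inner_smul_right, ← hsymm v (T v),
    real_inner_self_eq_norm_sq] at h1
  refine le_of_sq_le_sq ?_ (by positivity)
  have h4 : M * ‖T v‖ ^ 2 ≤ M * (M * ‖v‖) ^ 2 := by
    nlinarith [mul_le_mul_of_nonneg_left h2 (sq_nonneg M)]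
  exact le_of_mul_le_mul_left h4 hM

/-- **Robbins–Siegmund** for almost supermartingales with a deterministic summable
perturbation. -/
theorem ae_tendsto_and_summable_of_condExp_le_add_sub {Ω : Type*} {m0 : MeasurableSpace Ω}
    {μ : Measure Ω} [IsFiniteMeasure μ] {ℱ : Filtration ℕ m0} {V U : ℕ → Ω → ℝ} {γ : ℕ → ℝ}
    (hV_adp : StronglyAdapted ℱ V) (hU_adp : StronglyAdapted ℱ U)
    (hV_int : ∀ t, Integrable (V t) μ) (hU_int : ∀ t, Integrable (U t) μ)
    (hV : ∀ t ω, 0 ≤ V t ω) (hU : ∀ t ω, 0 ≤ U t ω) (hγ : ∀ t, 0 ≤ γ t) (hγ_sum : Summable γ)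
    (h : ∀ t, μ[V (t + 1) | ℱ t] ≤ᵐ[μ] fun ω => V t ω + γ t - U t ω) :
    ∀ᵐ ω ∂μ, (∃ l, Tendsto (fun t => V t ω) atTop (𝓝 l)) ∧ Summable fun t => U t ω := by
  let D : ℕ → Ω → ℝ := fun t ω => ∑ i ∈ Finset.range t, (U i ω - γ i)
  let S : ℕ → Ω → ℝ := fun t => V t + D t
  have hD_int (t : ℕ) : Integrable (D t) μ :=
    integrable_finsetSum _ fun i _ => (hU_int i).sub (integrable_const _)
  have hD_meas (s t : ℕ) (hst : t ≤ s + 1) : StronglyMeasurable[ℱ s] (D t) := by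
    refine Finset.stronglyMeasurable_fun_sum _ fun i hi => ?_
    exact ((hU_adp i).mono (ℱ.mono (by have := Finset.mem_range.1 hi; omega))).sub
      stronglyMeasurable_const
  have hS_int (t : ℕ) : Integrable (S t) μ := (hV_int t).add (hD_int t)
  have hS : Supermartingale S ℱ μ := by
    refine supermartingale_nat (fun t => (hV_adp t).add (hD_meas t t (by omega))) hS_int
      fun t => ?_
    have hadd := condExp_add (hV_int (t + 1)) (hD_int (t + 1)) (ℱ t)
    rw [condExp_of_stronglyMeasurable (ℱ.le t) (hD_meas t (t + 1) le_rfl) (hD_int _)] at hadd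
    filter_upwards [h t, hadd] with ω h1 h2
    refine h2.le.trans ?_
    simp only [Pi.add_apply, S, D, Finset.sum_range_succ]
    linarith
  have hγ_le (t : ℕ) : ∑ i ∈ Finset.range t, γ i ≤ ∑' i, γ i :=
    hγ_sum.sum_le_tsum _ fun i _ => hγ i
  have hS_low (t : ℕ) (ω : Ω) : -∑' i, γ i ≤ S t ω := by
    have h1 : 0 ≤ ∑ i ∈ Finset.range t, U i ω := Finset.sum_nonneg fun i _ => hU i ω
    simp only [Pi.add_apply, S, D, Finset.sum_sub_distrib]
    linarith [hV t ω, hγ_le t]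
  have hG : 0 ≤ ∑' i, γ i := tsum_nonneg hγ
  have hbdd (t : ℕ) : eLpNorm ((-S) t) 1 μ
      ≤ (((∫ ω, S 0 ω ∂μ) + ∫ _, 2 * ∑' i, γ i ∂μ).toNNReal : ENNReal) := by
    rw [Pi.neg_apply, eLpNorm_neg, eLpNorm_one_eq_lintegral_enorm,
      ← ofReal_integral_norm_eq_lintegral_enorm (hS_int t)]
    refine ENNReal.ofReal_le_ofReal ?_
    have h0 : ∫ ω, S t ω ∂μ ≤ ∫ ω, S 0 ω ∂μ := by
      simpa using hS.setIntegral_le (Nat.zero_le t) (MeasurableSet.univ (α := Ω))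
    have h1 : ∫ ω, ‖S t ω‖ ∂μ ≤ ∫ ω, (S t ω + 2 * ∑' i, γ i) ∂μ := by
      refine integral_mono (hS_int t).norm ((hS_int t).add (integrable_const _)) fun ω => ?_
      have := hS_low t ω
      exact abs_le.2 ⟨by linarith, by linarith⟩
    rw [integral_add (hS_int t) (integrable_const _)] at h1
    linarith
  filter_upwards [hS.neg.exists_ae_tendsto_of_bdd hbdd] with ω ⟨c, hc⟩
  have hSlim : Tendsto (fun t => S t ω) atTop (𝓝 (-c)) := by simpa using hc.neg
  obtain ⟨b, hb⟩ := hSlim.bddAbove_range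
  have hU_sum : Summable fun t => U t ω := by
    refine summable_of_sum_range_le (fun t => hU t ω) (c := b + ∑' i, γ i) fun t => ?_
    have h1 : S t ω ≤ b := hb ⟨t, rfl⟩
    simp only [Pi.add_apply, S, D, Finset.sum_sub_distrib] at h1
    linarith [hV t ω, hγ_le t]
  refine ⟨⟨_, (hSlim.sub (hU_sum.sub hγ_sum).hasSum.tendsto_sum_nat).congr fun t => ?_⟩, hU_sum⟩
  simp [S, D]

/-- **Robbins–Siegmund theorem** with deterministic summable coefficients. -/
theorem ae_tendsto_and_summable_of_condExp_le_one_add_mul {Ω : Type*} {m0 : MeasurableSpace Ω}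
    {μ : Measure Ω} [IsFiniteMeasure μ] {ℱ : Filtration ℕ m0} {V U : ℕ → Ω → ℝ} {β γ : ℕ → ℝ}
    (hV_adp : StronglyAdapted ℱ V) (hU_adp : StronglyAdapted ℱ U)
    (hV_int : ∀ t, Integrable (V t) μ) (hU_int : ∀ t, Integrable (U t) μ)
    (hV : ∀ t ω, 0 ≤ V t ω) (hU : ∀ t ω, 0 ≤ U t ω)
    (hβ : ∀ t, 0 ≤ β t) (hβ_sum : Summable β) (hγ : ∀ t, 0 ≤ γ t) (hγ_sum : Summable γ)
    (h : ∀ t, μ[V (t + 1) | ℱ t] ≤ᵐ[μ] fun ω => (1 + β t) * V t ω + γ t - U t ω) :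
    ∀ᵐ ω ∂μ, (∃ l, Tendsto (fun t => V t ω) atTop (𝓝 l)) ∧ Summable fun t => U t ω := by
  let P : ℕ → ℝ := fun t => ∏ i ∈ Finset.range t, (1 + β i)
  have hP_succ (t : ℕ) : P (t + 1) = P t * (1 + β t) := Finset.prod_range_succ _ _
  have hP_one (t : ℕ) : 1 ≤ P t := Finset.one_le_prod fun i _ => by linarith [hβ i]
  have hP_pos (t : ℕ) : 0 < P t := zero_lt_one.trans_le (hP_one t)
  obtain ⟨L, hL⟩ : ∃ L, Tendsto P atTop (𝓝 L) :=
    ⟨_, (multipliable_one_add_of_summable hβ_sum.norm).hasProd.tendsto_prod_nat⟩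
  obtain ⟨b, hb⟩ := hL.bddAbove_range
  have hscaled := ae_tendsto_and_summable_of_condExp_le_add_sub (μ := μ) (ℱ := ℱ)
    (V := fun t => (P t)⁻¹ • V t) (U := fun t => (P (t + 1))⁻¹ • U t)
    (γ := fun t => (P (t + 1))⁻¹ * γ t)
    (fun t => (hV_adp t).const_smul _) (fun t => (hU_adp t).const_smul _)
    (fun t => (hV_int t).smul _) (fun t => (hU_int t).smul _)
    (fun t ω => mul_nonneg (inv_nonneg.2 (hP_pos _).le) (hV t ω))
    (fun t ω => mul_nonneg (inv_nonneg.2 (hP_pos _).le) (hU t ω))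
    (fun t => mul_nonneg (inv_nonneg.2 (hP_pos _).le) (hγ t))
    (hγ_sum.of_nonneg_of_le (fun t => mul_nonneg (inv_nonneg.2 (hP_pos _).le) (hγ t))
      fun t => mul_le_of_le_one_left (hγ t) (inv_le_one_of_one_le₀ (hP_one _)))
    (fun t => by
      filter_upwards [h t, condExp_smul (μ := μ) (P (t + 1))⁻¹ (V (t + 1)) (ℱ t)] with ω h1 h2
      refine h2.le.trans ?_
      simp only [Pi.smul_apply, smul_eq_mul]
      have h3 := mul_le_mul_of_nonneg_left h1 (inv_nonneg.2 (hP_pos (t + 1)).le)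
      have h4 : (P t)⁻¹ = (P (t + 1))⁻¹ * (1 + β t) := by
        rw [hP_succ]
        have := hP_pos t
        have := hβ t
        field_simp
      rw [h4]
      linarith)
  filter_upwards [hscaled] with ω ⟨⟨l, hl⟩, hsum⟩
  refine ⟨⟨_, (hl.mul hL).congr fun t => ?_⟩, ?_⟩
  · have := (hP_pos t).ne'
    simp only [Pi.smul_apply, smul_eq_mul]
    field_simp
  · refine (hsum.mul_left b).of_nonneg_of_le (fun t => hU t ω) fun t => ?_
    have h1 : P (t + 1) ≤ b := hb ⟨t + 1, rfl⟩
    have h2 : U t ω = P (t + 1) * ((P (t + 1))⁻¹ * U t ω) := by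
      rw [mul_inv_cancel_left₀ (hP_pos _).ne']
    exact h2.le.trans (mul_le_mul_of_nonneg_right h1
      (mul_nonneg (inv_nonneg.2 (hP_pos _).le) (hU t ω)))

/-- **Robbins–Siegmund conclusions for the variable metric SGD iterates.**
Under (C.1)–(C.6) and `C` non-negative, almost surely the cost values
`C (w t)` converge to a finite limit and `∑ t, a t ‖∇C (w t)‖² < ∞`. -/
theorem variable_metric_sgd_robbins_siegmund_step
    {n : ℕ} {Ω : Type*} {m0 : MeasurableSpace Ω}
    {μ : Measure Ω} [IsProbabilityMeasure μ] (ℱ : Filtration ℕ m0)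
    (C : EuclideanSpace ℝ (Fin n) → ℝ)
    (hC : ContDiff ℝ 2 C)
    (hC_nonneg : ∀ v, 0 ≤ C v)
    (wstar : EuclideanSpace ℝ (Fin n))
    (hmin : ∀ v, C wstar ≤ C v)
    (huniq : ∀ v, (∀ u, C v ≤ C u) → v = wstar)
    (w Y : ℕ → Ω → EuclideanSpace ℝ (Fin n))
    (B : ℕ → Ω → (EuclideanSpace ℝ (Fin n) →L[ℝ] EuclideanSpace ℝ (Fin n)))
    (a : ℕ → ℝ) (ha : ∀ t, 0 < a t)
    (hw_meas : ∀ t, StronglyMeasurable[ℱ t] (w t))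
    (hB_meas : ∀ t, StronglyMeasurable[ℱ t] (B t))
    (hY_meas : ∀ t, StronglyMeasurable[ℱ (t + 1)] (Y t))
    (hY_int : ∀ t, Integrable (Y t) μ)
    (hupdate : ∀ t ω, w (t + 1) ω = w t ω - a t • (B t ω) (Y t ω))
    -- (C.1)
    (hC1 : ∀ t, μ[Y t | ℱ t] =ᵐ[μ] fun ω => gradient C (w t ω))
    -- (C.2)
    (K : ℝ) (hC2 : ∀ v, ‖fderiv ℝ (gradient C) v‖ ≤ 2 * K)
    -- (C.3)
    (hC3 : ∀ δ : ℝ, 0 < δ → ∃ c > 0, ∀ v, C v - C wstar > δ → c ≤ ‖gradient C v‖)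
    -- (C.4)
    (A Bc : ℝ) (hA : 0 ≤ A) (hBc : 0 ≤ Bc)
    (hYsq_int : ∀ t, Integrable (fun ω => ‖Y t ω‖ ^ 2) μ)
    (hC4 : ∀ t, ∀ᵐ ω ∂μ,
      (μ[fun ω' => ‖Y t ω'‖ ^ 2 | ℱ t]) ω ≤ A + Bc * C (w t ω))
    -- (C.5)
    (m M : ℝ) (hm : 0 < m) (hmM : m < M)
    (hC5 : ∀ t, ∀ᵐ ω ∂μ,
      (∀ u v, ⟪(B t ω) u, v⟫ = ⟪u, (B t ω) v⟫) ∧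
        ∀ v, m * ‖v‖ ^ 2 ≤ ⟪v, (B t ω) v⟫ ∧ ⟪v, (B t ω) v⟫ ≤ M * ‖v‖ ^ 2)
    -- (C.6)
    (hC6a : Summable fun t => (a t) ^ 2)
    (hC6b : ¬ Summable a) :
    ∀ᵐ ω ∂μ,
      (∃ l : ℝ, Tendsto (fun t => C (w t ω)) atTop (𝓝 l)) ∧
        Summable (fun t => a t * ‖gradient C (w t ω)‖ ^ 2) := by
  have hK : 0 ≤ K := by linarith [(norm_nonneg _).trans (hC2 0)]
  have hM : 0 < M := hm.trans hmM
  have hgrad_eq : gradient C = fun v => (InnerProductSpace.toDual ℝ _).symm (fderiv ℝ C v) := rfl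
  have hC_diff : Differentiable ℝ C := hC.differentiable (by norm_num)
  have hgrad_diff : Differentiable ℝ (gradient C) := by
    rw [hgrad_eq]
    exact (InnerProductSpace.toDual ℝ _).symm.toContinuousLinearEquiv.differentiable.comp
      ((hC.fderiv_right (m := 1) (by norm_num)).differentiable (by norm_num))
  have hg_meas (t : ℕ) : StronglyMeasurable[ℱ t] fun ω => gradient C (w t ω) :=
    hgrad_diff.continuous.comp_stronglyMeasurable (hw_meas t)
  have hBg_meas (t : ℕ) : StronglyMeasurable[ℱ t] fun ω => B t ω (gradient C (w t ω)) :=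
    isBoundedBilinearMap_apply.continuous.comp_stronglyMeasurable
      ((hB_meas t).prodMk (hg_meas t))
  have hgsq_int (t : ℕ) : Integrable (fun ω => ‖gradient C (w t ω)‖ ^ 2) μ := by
    have hY : MemLp (Y t) 2 μ := (memLp_two_iff_integrable_sq_norm (hY_int t).1).2 (hYsq_int t)
    exact ((hY.condExp (m := ℱ t) one_le_two).ae_eq (hC1 t)).integrable_norm_pow two_ne_zero
  have hB_norm (t : ℕ) : ∀ᵐ ω ∂μ, ∀ v, ‖B t ω v‖ ≤ M * ‖v‖ := by
    filter_upwards [hC5 t] with ω hω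
    exact norm_apply_le_of_symmetric_of_inner_le hM hω.1
      (fun v => (by positivity : 0 ≤ m * ‖v‖ ^ 2).trans (hω.2 v).1) fun v => (hω.2 v).2
  have hinner_int (t : ℕ) :
      Integrable (fun ω => ⟪B t ω (gradient C (w t ω)), Y t ω⟫) μ := by
    refine (((hgsq_int t).add (hYsq_int t)).const_mul M).mono'
      (((hBg_meas t).mono (ℱ.le t)).aestronglyMeasurable.inner (hY_int t).1) ?_
    filter_upwards [hB_norm t] with ω hω
    refine (norm_inner_le_norm _ _).trans
      ((mul_le_mul_of_nonneg_right (hω _) (norm_nonneg _)).trans ?_)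
    simp only [Pi.add_apply]
    rw [mul_assoc]
    refine mul_le_mul_of_nonneg_left ?_ hM.le
    nlinarith [sq_nonneg (‖gradient C (w t ω)‖ - ‖Y t ω‖), sq_nonneg ‖gradient C (w t ω)‖,
      sq_nonneg ‖Y t ω‖]
  let Z : ℕ → Ω → ℝ := fun t =>
    (-a t) • (fun ω => ⟪B t ω (gradient C (w t ω)), Y t ω⟫)
      + (K * M ^ 2 * a t ^ 2) • fun ω => ‖Y t ω‖ ^ 2
  have hZ_int (t : ℕ) : Integrable (Z t) μ :=
    ((hinner_int t).smul _).add ((hYsq_int t).smul _)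
  have hdescent (t : ℕ) : ∀ᵐ ω ∂μ, C (w (t + 1) ω) ≤ C (w t ω) + Z t ω := by
    filter_upwards [hC5 t, hB_norm t] with ω hω hBω
    have h1 := le_add_inner_gradient_add_sq hC_diff hgrad_diff hC2 (w t ω)
      (-(a t • (B t ω) (Y t ω)))
    rw [← sub_eq_add_neg, ← hupdate, inner_neg_right, real_inner_smul_right, ← hω.1, norm_neg,
      norm_smul, Real.norm_of_nonneg (ha t).le, mul_pow] at h1
    have h2 := pow_le_pow_left₀ (norm_nonneg _) (hBω (Y t ω)) 2
    have h3 := mul_le_mul_of_nonneg_left h2 (mul_nonneg hK (sq_nonneg (a t)))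
    simp only [Z, Pi.add_apply, Pi.smul_apply, smul_eq_mul]
    linarith
  have hZ_condExp (t : ℕ) : ∀ᵐ ω ∂μ, (μ[Z t | ℱ t]) ω ≤
      K * M ^ 2 * a t ^ 2 * (A + Bc * C (w t ω)) - m * (a t * ‖gradient C (w t ω)‖ ^ 2) := by
    have hpull : μ[fun ω => ⟪B t ω (gradient C (w t ω)), Y t ω⟫ | ℱ t] =ᵐ[μ]
        fun ω => ⟪B t ω (gradient C (w t ω)), (μ[Y t | ℱ t]) ω⟫ :=
      condExp_bilin_of_stronglyMeasurable_left (innerSL ℝ) (hBg_meas t) (hinner_int t) (hY_int t)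
    filter_upwards [hpull, hC1 t, hC4 t, hC5 t,
      condExp_add ((hinner_int t).smul (-a t)) ((hYsq_int t).smul (K * M ^ 2 * a t ^ 2)) (ℱ t),
      condExp_smul (μ := μ) (-a t) (fun ω => ⟪B t ω (gradient C (w t ω)), Y t ω⟫) (ℱ t),
      condExp_smul (μ := μ) (K * M ^ 2 * a t ^ 2) (fun ω => ‖Y t ω‖ ^ 2) (ℱ t)]
      with ω h1 h2 h3 h4 h5 h6 h7
    refine h5.le.trans ?_
    rw [Pi.add_apply, h6, h7, Pi.smul_apply, Pi.smul_apply, h1, h2, smul_eq_mul, smul_eq_mul,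
      h4.1]
    have h8 := mul_le_mul_of_nonneg_left (h4.2 (gradient C (w t ω))).1 (ha t).le
    have h9 := mul_le_mul_of_nonneg_left h3 (by positivity : 0 ≤ K * M ^ 2 * a t ^ 2)
    linarith
  have hlocal (N : ℕ) : ∀ᵐ ω ∂μ, C (w 0 ω) ≤ N →
      (∃ l : ℝ, Tendsto (fun t => C (w t ω)) atTop (𝓝 l)) ∧
        Summable (fun t => a t * ‖gradient C (w t ω)‖ ^ 2) := by
    let s : Set Ω := {ω | C (w 0 ω) ≤ N}
    have hCw_meas (t : ℕ) : StronglyMeasurable[ℱ t] fun ω => C (w t ω) :=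
      hC.continuous.comp_stronglyMeasurable (hw_meas t)
    have hs (t : ℕ) : MeasurableSet[ℱ t] s :=
      ℱ.mono (Nat.zero_le t) _
        ((hCw_meas 0).measurableSet_le stronglyMeasurable_const)
    let V : ℕ → Ω → ℝ := fun t => s.indicator fun ω => C (w t ω)
    let U : ℕ → Ω → ℝ := fun t => s.indicator fun ω => m * (a t * ‖gradient C (w t ω)‖ ^ 2)
    have hV_adp : StronglyAdapted ℱ V := fun t => (hCw_meas t).indicator (hs t)
    have hU_adp : StronglyAdapted ℱ U := fun t =>
      ((((hg_meas t).norm.pow 2).const_mul (a t)).const_mul m).indicator (hs t)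
    have hV_nonneg (t : ℕ) (ω : Ω) : 0 ≤ V t ω := Set.indicator_nonneg (fun _ _ => hC_nonneg _) _
    have hU_nonneg (t : ℕ) (ω : Ω) : 0 ≤ U t ω :=
      Set.indicator_nonneg (fun _ _ => by have := ha t; positivity) _
    have hV_le (t : ℕ) : V (t + 1) ≤ᵐ[μ] V t + s.indicator (Z t) := by
      filter_upwards [hdescent t] with ω hω
      by_cases hωs : ω ∈ s <;> simp [V, hωs, hω]
    have hZs_int (t : ℕ) : Integrable (s.indicator (Z t)) μ :=
      (hZ_int t).indicator (ℱ.le t _ (hs t))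
    have hV_int (t : ℕ) : Integrable (V t) μ := by
      induction t with
      | zero =>
        refine (integrable_const (N : ℝ)).mono' ((hV_adp 0).mono (ℱ.le 0)).aestronglyMeasurable
          (ae_of_all _ fun ω => ?_)
        rw [Real.norm_of_nonneg (hV_nonneg 0 ω)]
        exact Set.indicator_le' (fun ω hω => hω) (fun _ _ => Nat.cast_nonneg N) ω
      | succ t ih =>
        refine (ih.add (hZs_int t)).mono' ((hV_adp _).mono (ℱ.le _)).aestronglyMeasurable ?_
        filter_upwards [hV_le t] with ω hω
        rwa [Real.norm_of_nonneg (hV_nonneg _ ω)]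
    have hU_int (t : ℕ) : Integrable (U t) μ :=
      (((hgsq_int t).const_mul (a t)).const_mul m).indicator (ℱ.le t _ (hs t))
    have hRS := ae_tendsto_and_summable_of_condExp_le_one_add_mul
      (β := fun t => K * M ^ 2 * Bc * a t ^ 2) (γ := fun t => K * M ^ 2 * A * a t ^ 2)
      hV_adp hU_adp hV_int hU_int hV_nonneg hU_nonneg (fun t => by positivity)
      (hC6a.mul_left _) (fun t => by positivity) (hC6a.mul_left _) (fun t => by
        have hadd := condExp_add (hV_int t) (hZs_int t) (ℱ t)
        rw [condExp_of_stronglyMeasurable (ℱ.le t) (hV_adp t) (hV_int t)] at hadd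
        filter_upwards [condExp_mono (m := ℱ t) (hV_int (t + 1)) ((hV_int t).add (hZs_int t))
          (hV_le t), hadd, condExp_indicator (hZ_int t) (hs t), hZ_condExp t] with ω h1 h2 h3 h4
        refine h1.trans (h2.le.trans ?_)
        rw [Pi.add_apply, h3]
        by_cases hωs : ω ∈ s
        · simp only [V, U, Set.indicator_of_mem hωs]
          linarith
        · simp only [V, U, Set.indicator_of_notMem hωs]
          have : 0 ≤ K * M ^ 2 * A * a t ^ 2 := by positivity
          linarith)
    filter_upwards [hRS] with ω hω hωN
    have hωs : ω ∈ s := hωN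
    simp only [V, U, Set.indicator_of_mem hωs] at hω
    exact ⟨hω.1, (summable_mul_left_iff hm.ne').1 hω.2⟩
  filter_upwards [ae_all_iff.2 hlocal] with ω hω
  obtain ⟨N, hN⟩ := exists_nat_ge (C (w 0 ω))
  exact hω N hN
end
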